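/- Let (Z,ρ₀) be an antipodal space and let ρ₁ ∈ M(Z). Then the map φ_{ρ₁} : M(Z) → C(Z) sending ρ to log(dρ/dρ₁) is an isometric embedding of the metric space (M(Z), d_M) into the Banach space C(Z) of continuous real-valued functions on Z with the supremum norm, and its image is a closed subset of C(Z). -/

import Mathlib

open Filter Topology
open scoped Classical

variable {Z : Type*}

/-- `Z` has at least four points. -/
def HasFourPoints (Z : Type*) : Prop :=
  ∃ a b c d : Z, a ≠ b ∧ a ≠ c ∧ a ≠ d ∧ b ≠ c ∧ b ≠ d ∧ c ≠ d

/-- A separating function on `Z`: continuous, symmetric, and positive. -/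
structure IsSeparating [TopologicalSpace Z] (ρ : Z → Z → ℝ) : Prop where
  continuous : Continuous fun p : Z × Z => ρ p.1 p.2
  symm : ∀ ξ η, ρ ξ η = ρ η ξ
  nonneg : ∀ ξ η, 0 ≤ ρ ξ η
  eq_zero_iff : ∀ ξ η, ρ ξ η = 0 ↔ ξ = η

/-- The cross-ratio of a quadruple of points with respect to `ρ`. -/
noncomputable def crossRatio (ρ : Z → Z → ℝ) (ξ ξ' η η' : Z) : ℝ :=
  ρ ξ η * ρ ξ' η' / (ρ ξ η' * ρ ξ' η)

/-- Two functions are Moebius equivalent if their cross-ratios agree on all quadruples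
of pairwise distinct points. -/
def MoebiusEquiv (ρ₁ ρ₂ : Z → Z → ℝ) : Prop :=
  ∀ ξ ξ' η η' : Z, ξ ≠ ξ' → ξ ≠ η → ξ ≠ η' → ξ' ≠ η → ξ' ≠ η' → η ≠ η' →
    crossRatio ρ₁ ξ ξ' η η' = crossRatio ρ₂ ξ ξ' η η'

/-- An antipodal function on `Z`: a separating function with values in `[0,1]` such that
every point has an antipode. -/
structure IsAntipodal [TopologicalSpace Z] (ρ : Z → Z → ℝ) : Prop where
  toIsSeparating : IsSeparating ρ
  le_one : ∀ ξ η, ρ ξ η ≤ 1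
  antipode : ∀ ξ, ∃ η, ρ ξ η = 1

/-- The Moebius space `M(Z, ρ₀)`: antipodal functions Moebius equivalent to `ρ₀`. -/
def MoebiusSpace [TopologicalSpace Z] (ρ₀ : Z → Z → ℝ) : Set (Z → Z → ℝ) :=
  {ρ | IsAntipodal ρ ∧ MoebiusEquiv ρ₀ ρ}

/-- The derivative `dρ₂/dρ₁`: the (unique, when it exists) positive continuous function
satisfying the geometric mean value theorem
`ρ₂(ξ,η)² = f(ξ) f(η) ρ₁(ξ,η)²`. -/
noncomputable def mDeriv [TopologicalSpace Z] (ρ₁ ρ₂ : Z → Z → ℝ) : Z → ℝ :=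
  if h : ∃ f : Z → ℝ, Continuous f ∧ (∀ ξ, 0 < f ξ) ∧
      ∀ ξ η, ρ₂ ξ η ^ 2 = f ξ * f η * ρ₁ ξ η ^ 2
  then h.choose else fun _ => 1

/-- The metric `d_M(ρ₁, ρ₂) = ‖log (dρ₂/dρ₁)‖_∞` on the Moebius space. -/
noncomputable def dM [TopologicalSpace Z] (ρ₁ ρ₂ : Z → Z → ℝ) : ℝ :=
  ⨆ ξ : Z, |Real.log (mDeriv ρ₁ ρ₂ ξ)|

/-- The discrepancy function `D_{ρ₁}(τ)(ξ) = max_{η ≠ ξ} (τ(ξ) + τ(η) + log ρ₁(ξ,η)²)`. -/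
noncomputable def discrepancy [TopologicalSpace Z] (ρ₁ : Z → Z → ℝ) (τ : C(Z, ℝ))
    (ξ : Z) : ℝ :=
  ⨆ η : {η : Z // η ≠ ξ}, (τ ξ + τ η.1 + Real.log (ρ₁ ξ η.1 ^ 2))

/-- `E_{ρ₁}(τ)(ξ,η) = e^{τ(ξ)/2} e^{τ(η)/2} ρ₁(ξ,η)`. -/
noncomputable def eMap [TopologicalSpace Z] (ρ₁ : Z → Z → ℝ) (τ : C(Z, ℝ)) :
    Z → Z → ℝ :=
  fun ξ η => Real.exp (τ ξ / 2) * Real.exp (τ η / 2) * ρ₁ ξ η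

/-- A solution of the `ρ₁`-antipodal flow `dτ_t/dt = -D_{ρ₁}(τ_t)` on `[0, ∞)`. -/
def IsAntipodalFlowSol [TopologicalSpace Z] [CompactSpace Z]
    (ρ₁ : Z → Z → ℝ) (τ : ℝ → C(Z, ℝ)) : Prop :=
  ∀ t ∈ Set.Ici (0 : ℝ), ∃ τ' : C(Z, ℝ),
    (∀ ξ, τ' ξ = -discrepancy ρ₁ (τ t) ξ) ∧
    HasDerivWithinAt τ τ' (Set.Ici (0 : ℝ)) t

/-- The antipodalization map `P_∞(τ₀, ρ₁) = E_{ρ₁}(τ_∞)`, where `τ_∞` is the limit as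
`t → ∞` of the solution of the `ρ₁`-antipodal flow starting at `τ₀`. -/
noncomputable def antipodalization [TopologicalSpace Z] [CompactSpace Z]
    (ρ₁ : Z → Z → ℝ) (τ₀ : C(Z, ℝ)) : Z → Z → ℝ :=
  if h : ∃ p : (ℝ → C(Z, ℝ)) × C(Z, ℝ), p.1 0 = τ₀ ∧ IsAntipodalFlowSol ρ₁ p.1 ∧
      Filter.Tendsto p.1 Filter.atTop (𝓝 p.2)
  then eMap ρ₁ h.choose.2 else ρ₁


/-- `f` is a derivative of `ρ₂` with respect to `ρ₁`: it is continuous, positive, and satisfies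
the geometric mean value theorem. -/
def IsMDeriv [TopologicalSpace Z] (ρ₁ ρ₂ : Z → Z → ℝ) (f : Z → ℝ) : Prop :=
  Continuous f ∧ (∀ ξ, 0 < f ξ) ∧ ∀ ξ η, ρ₂ ξ η ^ 2 = f ξ * f η * ρ₁ ξ η ^ 2

theorem HasFourPoints.exists_ne (h4 : HasFourPoints Z) (x y : Z) :
    ∃ a b : Z, a ≠ b ∧ a ≠ x ∧ a ≠ y ∧ b ≠ x ∧ b ≠ y := by
  obtain ⟨a, b, c, d, hab, hac, had, hbc, hbd, hcd⟩ := h4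
  by_cases hax : a = x <;> by_cases hay : a = y <;> by_cases hbx : b = x <;>
    by_cases hby : b = y <;> by_cases hcx : c = x <;> by_cases hcy : c = y <;>
    first
    | exact ⟨a, b, by grind⟩
    | exact ⟨a, c, by grind⟩
    | exact ⟨a, d, by grind⟩
    | exact ⟨b, c, by grind⟩
    | exact ⟨b, d, by grind⟩
    | exact ⟨c, d, by grind⟩

theorem IsSeparating.pos [TopologicalSpace Z] {ρ : Z → Z → ℝ} (h : IsSeparating ρ) {x y : Z}
    (hxy : x ≠ y) : 0 < ρ x y :=
  lt_of_le_of_ne (h.nonneg x y) fun h0 => hxy ((h.eq_zero_iff x y).1 h0.symm)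

theorem MoebiusEquiv.symm {ρ₁ ρ₂ : Z → Z → ℝ} (h : MoebiusEquiv ρ₁ ρ₂) : MoebiusEquiv ρ₂ ρ₁ :=
  fun a b c d h1 h2 h3 h4 h5 h6 => (h a b c d h1 h2 h3 h4 h5 h6).symm

theorem MoebiusEquiv.trans {ρ₁ ρ₂ ρ₃ : Z → Z → ℝ} (h : MoebiusEquiv ρ₁ ρ₂)
    (h' : MoebiusEquiv ρ₂ ρ₃) : MoebiusEquiv ρ₁ ρ₃ :=
  fun a b c d h1 h2 h3 h4 h5 h6 =>
    (h a b c d h1 h2 h3 h4 h5 h6).trans (h' a b c d h1 h2 h3 h4 h5 h6)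

/-- The multiplicative cocycle relation for `g = ρ₂ / ρ₁`. -/
theorem MoebiusEquiv.div_mul_div [TopologicalSpace Z] {ρ₁ ρ₂ : Z → Z → ℝ}
    (h₁ : IsSeparating ρ₁) (h₂ : IsSeparating ρ₂) (h : MoebiusEquiv ρ₁ ρ₂) {x y a b : Z}
    (hxy : x ≠ y) (hxa : x ≠ a) (hxb : x ≠ b) (hya : y ≠ a) (hyb : y ≠ b) (hab : a ≠ b) :
    (ρ₂ x a / ρ₁ x a) * (ρ₂ y b / ρ₁ y b) = (ρ₂ x b / ρ₁ x b) * (ρ₂ y a / ρ₁ y a) := by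
  have key := h x y a b hxy hxa hxb hya hyb hab
  unfold crossRatio at key
  have p1 := h₁.pos hxa
  have p2 := h₁.pos hxb
  have p3 := h₁.pos hya
  have p4 := h₁.pos hyb
  have q1 := h₂.pos hxb
  have q2 := h₂.pos hya
  rw [div_eq_div_iff (by positivity) (by positivity)] at key
  rw [div_mul_div_comm, div_mul_div_comm, div_eq_div_iff (by positivity) (by positivity)]
  linarith

/-- A symmetric positive function off the diagonal that satisfies the cocycle relation determines
a function of one variable, independently of the auxiliary points. -/
theorem cocycle_eq {g : Z → Z → ℝ} (gs : ∀ x y, g x y = g y x)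
    (gp : ∀ x y, x ≠ y → 0 < g x y)
    (gc : ∀ x y a b, x ≠ y → x ≠ a → x ≠ b → y ≠ a → y ≠ b → a ≠ b →
      g x a * g y b = g x b * g y a)
    {x a b c d : Z} (hab : a ≠ b) (hcd : c ≠ d) (ha : a ≠ x) (hb : b ≠ x) (hc : c ≠ x)
    (hd : d ≠ x) : g x a * g x b / g a b = g x c * g x d / g c d := by
  have replace_right : ∀ a b c, a ≠ x → b ≠ x → c ≠ x → a ≠ b → a ≠ c →
      g x a * g x b / g a b = g x a * g x c / g a c := by
    intro a b c ha hb hc hab hac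
    rcases eq_or_ne b c with rfl | hbc
    · rfl
    rw [div_eq_div_iff (gp _ _ hab).ne' (gp _ _ hac).ne']
    have := gc x a b c ha.symm hb.symm hc.symm hab hac hbc
    linear_combination (g x a) * this
  have comm : ∀ a b, g x a * g x b / g a b = g x b * g x a / g b a := by
    intro a b
    rw [gs a b, mul_comm]
  rcases eq_or_ne a d with rfl | had
  · rw [comm c a]
    exact replace_right a b c ha hb hc hab hcd.symm
  · rw [replace_right a b d ha hb hd hab had, comm a d, comm c d]
    exact replace_right d a c hd ha hc had.symm hcd.symm

theorem exists_isMDeriv [TopologicalSpace Z] [T1Space Z] (h4 : HasFourPoints Z)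
    {ρ₁ ρ₂ : Z → Z → ℝ} (h₁ : IsSeparating ρ₁) (h₂ : IsSeparating ρ₂)
    (h : MoebiusEquiv ρ₁ ρ₂) : ∃ f, IsMDeriv ρ₁ ρ₂ f := by
  set g : Z → Z → ℝ := fun x y => ρ₂ x y / ρ₁ x y with hg
  have gs : ∀ x y, g x y = g y x := fun x y => by simp only [hg, h₁.symm x y, h₂.symm x y]
  have gp : ∀ x y, x ≠ y → 0 < g x y := fun x y hxy => div_pos (h₂.pos hxy) (h₁.pos hxy)
  have gc : ∀ x y a b, x ≠ y → x ≠ a → x ≠ b → y ≠ a → y ≠ b → a ≠ b →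
      g x a * g y b = g x b * g y a :=
    fun x y a b => h.div_mul_div h₁ h₂
  choose A B hAB hA _ hB _ using fun x => h4.exists_ne x x
  have eq : ∀ {x a b}, a ≠ b → a ≠ x → b ≠ x →
      g x (A x) * g x (B x) / g (A x) (B x) = g x a * g x b / g a b :=
    fun hab ha hb => cocycle_eq gs gp gc (hAB _) hab (hA _) (hB _) ha hb
  refine ⟨fun x => g x (A x) * g x (B x) / g (A x) (B x), ?_, ?_, ?_⟩
  · rw [continuous_iff_continuousAt]
    intro x
    have hc : ∀ a, a ≠ x → ContinuousAt (fun y => g y a) x := by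
      intro a ha
      exact (h₂.continuous.comp (Continuous.prodMk_left a)).continuousAt.div
        (h₁.continuous.comp (Continuous.prodMk_left a)).continuousAt (h₁.pos ha.symm).ne'
    refine (((hc _ (hA x)).mul (hc _ (hB x))).div_const (g (A x) (B x))).congr ?_
    filter_upwards [isOpen_ne.mem_nhds (hA x).symm, isOpen_ne.mem_nhds (hB x).symm] with y hy hy'
    exact (eq (hAB x) (Ne.symm hy) (Ne.symm hy')).symm
  · intro x
    exact div_pos (mul_pos (gp _ _ (hA x).symm) (gp _ _ (hB x).symm)) (gp _ _ (hAB x))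
  · intro x y
    rcases eq_or_ne x y with rfl | hxy
    · simp [(h₁.eq_zero_iff x x).2 rfl, (h₂.eq_zero_iff x x).2 rfl]
    obtain ⟨a, -, -, hax, hay, -⟩ := h4.exists_ne x y
    have e : ρ₂ x y = g x y * ρ₁ x y := (div_mul_cancel₀ _ (h₁.pos hxy).ne').symm
    have p := (gp x a hax.symm).ne'
    have q := (gp y a hay.symm).ne'
    beta_reduce
    rw [e, eq hay.symm hxy.symm hax, eq hax.symm hxy hay, gs y x]
    field_simp

theorem IsMDeriv.unique [TopologicalSpace Z] (h4 : HasFourPoints Z) {ρ₁ ρ₂ : Z → Z → ℝ}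
    (h₁ : IsSeparating ρ₁) {f f' : Z → ℝ} (hf : IsMDeriv ρ₁ ρ₂ f) (hf' : IsMDeriv ρ₁ ρ₂ f') :
    f = f' := by
  have key : ∀ x y, x ≠ y → f x * f y = f' x * f' y := by
    intro x y hxy
    have := (hf.2.2 x y).symm.trans (hf'.2.2 x y)
    exact mul_right_cancel₀ (pow_pos (h₁.pos hxy) 2).ne' this
  funext x
  obtain ⟨a, b, hab, ha, -, hb, -⟩ := h4.exists_ne x x
  have e1 := key x a ha.symm
  have e2 := key x b hb.symm
  have e3 := key a b hab
  have hp : 0 < f' a * f' b := mul_pos (hf'.2.1 a) (hf'.2.1 b)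
  have hsq : f x ^ 2 = f' x ^ 2 := by
    refine mul_right_cancel₀ hp.ne' ?_
    rw [← e3]
    linear_combination (f x * f b) * e1 + (f' x * f' a) * e2 - (f' x ^ 2) * e3
  exact (pow_left_inj₀ (hf.2.1 x).le (hf'.2.1 x).le two_ne_zero).1 hsq

theorem IsMDeriv.mDeriv_eq [TopologicalSpace Z] (h4 : HasFourPoints Z) {ρ₁ ρ₂ : Z → Z → ℝ}
    (h₁ : IsSeparating ρ₁) {f : Z → ℝ} (hf : IsMDeriv ρ₁ ρ₂ f) : mDeriv ρ₁ ρ₂ = f := by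
  have hex : ∃ f, IsMDeriv ρ₁ ρ₂ f := ⟨f, hf⟩
  have : mDeriv ρ₁ ρ₂ = hex.choose := dif_pos hex
  rw [this]
  exact hex.choose_spec.unique h4 h₁ hf

theorem isMDeriv_mDeriv [TopologicalSpace Z] [T1Space Z] (h4 : HasFourPoints Z)
    {ρ₁ ρ₂ : Z → Z → ℝ} (h₁ : IsSeparating ρ₁) (h₂ : IsSeparating ρ₂)
    (h : MoebiusEquiv ρ₁ ρ₂) : IsMDeriv ρ₁ ρ₂ (mDeriv ρ₁ ρ₂) := by
  obtain ⟨f, hf⟩ := exists_isMDeriv h4 h₁ h₂ h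
  rwa [hf.mDeriv_eq h4 h₁]

theorem IsMDeriv.div [TopologicalSpace Z] {ρ₁ ρ₂ ρ₃ : Z → Z → ℝ} {f g : Z → ℝ}
    (hf : IsMDeriv ρ₁ ρ₂ f) (hg : IsMDeriv ρ₁ ρ₃ g) : IsMDeriv ρ₂ ρ₃ fun x => g x / f x := by
  refine ⟨hg.1.div hf.1 fun x => (hf.2.1 x).ne', fun x => div_pos (hg.2.1 x) (hf.2.1 x), ?_⟩
  intro x y
  have hx := (hf.2.1 x).ne'
  have hy := (hf.2.1 y).ne'
  rw [hg.2.2, hf.2.2]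
  field_simp

section eMap

variable [TopologicalSpace Z] {ρ₁ : Z → Z → ℝ}

theorem IsSeparating.eMap (h₁ : IsSeparating ρ₁) (τ : C(Z, ℝ)) : IsSeparating (eMap ρ₁ τ) where
  continuous := by
    have := h₁.continuous
    unfold _root_.eMap
    fun_prop
  symm ξ η := by
    unfold _root_.eMap
    rw [h₁.symm ξ η]
    ring
  nonneg ξ η := by
    have := h₁.nonneg ξ η
    unfold _root_.eMap
    positivity
  eq_zero_iff ξ η := by
    simp [_root_.eMap, h₁.eq_zero_iff]

theorem isMDeriv_eMap (ρ₁ : Z → Z → ℝ) (τ : C(Z, ℝ)) :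
    IsMDeriv ρ₁ (eMap ρ₁ τ) fun x => Real.exp (τ x) := by
  refine ⟨by fun_prop, fun x => Real.exp_pos _, fun x y => ?_⟩
  have h : ∀ z, Real.exp (τ z) = Real.exp (τ z / 2) ^ 2 := fun z => by
    rw [← Real.exp_nat_mul]
    congr 1
    push_cast
    ring
  unfold eMap
  beta_reduce
  rw [h x, h y]
  ring

theorem moebiusEquiv_eMap (ρ₁ : Z → Z → ℝ) (τ : C(Z, ℝ)) : MoebiusEquiv ρ₁ (eMap ρ₁ τ) := by
  intro x y a b _ _ _ _ _ _
  have hp : Real.exp (τ x / 2) * Real.exp (τ y / 2) * Real.exp (τ a / 2) * Real.exp (τ b / 2)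
      ≠ 0 := by positivity
  unfold crossRatio eMap
  rw [← mul_div_mul_left _ _ hp]
  congr 1 <;> ring

theorem eMap_eq_of_isMDeriv (h₁ : IsSeparating ρ₁) {ρ : Z → Z → ℝ} (h : IsSeparating ρ)
    {τ : C(Z, ℝ)} (hτ : IsMDeriv ρ₁ ρ fun x => Real.exp (τ x)) : eMap ρ₁ τ = ρ := by
  funext x y
  refine (pow_left_inj₀ ((h₁.eMap τ).nonneg x y) (h.nonneg x y) two_ne_zero).1 ?_
  rw [hτ.2.2, (isMDeriv_eMap ρ₁ τ).2.2]

theorem isClosed_setOf_isAntipodal_eMap [CompactSpace Z] [T2Space Z] (h₁ : IsSeparating ρ₁) :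
    IsClosed {τ : C(Z, ℝ) | IsAntipodal (eMap ρ₁ τ)} := by
  have heq : {τ : C(Z, ℝ) | IsAntipodal (eMap ρ₁ τ)} =
      (⋂ ξ, ⋂ η, {τ | eMap ρ₁ τ ξ η ≤ 1}) ∩
        ⋂ ξ, Prod.fst '' {p : C(Z, ℝ) × Z | eMap ρ₁ p.1 ξ p.2 = 1} := by
    ext τ
    simp only [Set.mem_ofPred_eq, Set.mem_inter_iff, Set.mem_iInter, Set.mem_image, Prod.exists,
      exists_and_right, exists_eq_right]
    exact ⟨fun h => ⟨h.le_one, h.antipode⟩, fun h => ⟨h₁.eMap τ, h.1, h.2⟩⟩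
  have hc := h₁.continuous
  rw [heq]
  refine IsClosed.inter (isClosed_iInter fun ξ => isClosed_iInter fun η => ?_)
    (isClosed_iInter fun ξ => isClosedMap_fst_of_compactSpace _ ?_)
  · refine isClosed_le ?_ continuous_const
    unfold eMap
    fun_prop
  · refine isClosed_eq ?_ continuous_const
    unfold eMap
    fun_prop

end eMap

theorem statement1 [TopologicalSpace Z] [CompactSpace Z]
    [TopologicalSpace.MetrizableSpace Z] (h4 : HasFourPoints Z)
    (ρ₀ : Z → Z → ℝ) (h₀ : IsAntipodal ρ₀)
    (ρ₁ : Z → Z → ℝ) (hρ₁ : ρ₁ ∈ MoebiusSpace ρ₀) :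
    ∃ Φ : MoebiusSpace ρ₀ → C(Z, ℝ),
      (∀ (ρ : MoebiusSpace ρ₀) (ξ : Z), Φ ρ ξ = Real.log (mDeriv ρ₁ ρ.1 ξ)) ∧
      Function.Injective Φ ∧
      (∀ ρ σ : MoebiusSpace ρ₀, ‖Φ ρ - Φ σ‖ = dM ρ.1 σ.1) ∧
      IsClosed (Set.range Φ) := by
  have sep : ∀ ρ ∈ MoebiusSpace ρ₀, IsSeparating ρ := fun ρ h => h.1.toIsSeparating
  have hD : ∀ ρ ∈ MoebiusSpace ρ₀, IsMDeriv ρ₁ ρ (mDeriv ρ₁ ρ) := fun ρ h =>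
    isMDeriv_mDeriv h4 (sep _ hρ₁) (sep _ h) (hρ₁.2.symm.trans h.2)
  let Φ : MoebiusSpace ρ₀ → C(Z, ℝ) := fun ρ =>
    ⟨fun ξ => Real.log (mDeriv ρ₁ ρ.1 ξ),
      (hD _ ρ.2).1.log fun ξ => ((hD _ ρ.2).2.1 ξ).ne'⟩
  have eMap_Φ : ∀ ρ, eMap ρ₁ (Φ ρ) = ρ.1 := by
    intro ρ
    refine eMap_eq_of_isMDeriv (sep _ hρ₁) (sep _ ρ.2) ?_
    have : (fun x => Real.exp (Φ ρ x)) = mDeriv ρ₁ ρ.1 :=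
      funext fun x => Real.exp_log ((hD _ ρ.2).2.1 x)
    rw [this]
    exact hD _ ρ.2
  refine ⟨Φ, fun _ _ => rfl, ?_, ?_, ?_⟩
  · intro ρ σ h
    apply Subtype.ext
    rw [← eMap_Φ ρ, h, eMap_Φ σ]
  · intro ρ σ
    rw [norm_sub_rev, ContinuousMap.norm_eq_iSup_norm, dM,
      ((hD _ ρ.2).div (hD _ σ.2)).mDeriv_eq h4 (sep _ ρ.2)]
    refine iSup_congr fun ξ => ?_
    rw [Real.log_div ((hD _ σ.2).2.1 ξ).ne' ((hD _ ρ.2).2.1 ξ).ne']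
    rfl
  · have hrange : Set.range Φ = {τ : C(Z, ℝ) | IsAntipodal (eMap ρ₁ τ)} := by
      ext τ
      constructor
      · rintro ⟨ρ, rfl⟩
        rw [Set.mem_ofPred_eq, eMap_Φ]
        exact ρ.2.1
      · intro h
        refine ⟨⟨eMap ρ₁ τ, h, hρ₁.2.trans (moebiusEquiv_eMap ρ₁ τ)⟩, ?_⟩
        ext ξ
        change Real.log (mDeriv ρ₁ (eMap ρ₁ τ) ξ) = τ ξ
        rw [(isMDeriv_eMap ρ₁ τ).mDeriv_eq h4 (sep _ hρ₁), Real.log_exp]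
    rw [hrange]
    exact isClosed_setOf_isAntipodal_eMap (sep _ hρ₁)
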